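/- arXiv:1604.07245 — 2 statements merged into one kernel-verified Lean document; each statement's English description precedes it below -/
import Mathlib

section
/- For every unit vector u = (a,b,c) ∈ ℝ³ (a² + b² + c² = 1), the support function of the oloid Ω₁ satisfies sup{⟨x,u⟩ : x ∈ Ω₁} = max{ √(a²+b²) − b/2 , √(b²+c²) + b/2 }. -/
open MeasureTheory Real Pointwise

noncomputable section

/-- The circle `k_A = {(x,y,z) : x² + (y+1/2)² = 1 ∧ z = 0}`. -/
def kA : Set (EuclideanSpace ℝ (Fin 3)) :=
  {p | p 0 ^ 2 + (p 1 + 1/2) ^ 2 = 1 ∧ p 2 = 0}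

/-- The circle `k_B = {(x,y,z) : (y−1/2)² + z² = 1 ∧ x = 0}`. -/
def kB : Set (EuclideanSpace ℝ (Fin 3)) :=
  {p | (p 1 - 1/2) ^ 2 + p 2 ^ 2 = 1 ∧ p 0 = 0}

/-- The oloid `Ω₁`: the convex hull of `k_A ∪ k_B`. -/
def oloid : Set (EuclideanSpace ℝ (Fin 3)) := convexHull ℝ (kA ∪ kB)

/-- The scaled oloid `Ω_r = r • Ω₁`. -/
def oloidR (r : ℝ) : Set (EuclideanSpace ℝ (Fin 3)) := r • oloid

/-- Complete elliptic integral of the first kind `K(k)`. -/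
def ellipticK (k : ℝ) : ℝ := ∫ x in (0:ℝ)..(π/2), 1 / Real.sqrt (1 - k^2 * Real.sin x ^ 2)

/-- Complete elliptic integral of the second kind `E(k)`. -/
def ellipticE (k : ℝ) : ℝ := ∫ x in (0:ℝ)..(π/2), Real.sqrt (1 - k^2 * Real.sin x ^ 2)

/-- The constant `I = ∫₀^{π/2} arccos(cos x/(1+cos x)) dx`. -/
def constI : ℝ := ∫ x in (0:ℝ)..(π/2), Real.arccos (Real.cos x / (1 + Real.cos x))

/-- Support function `h_C(u) = sup {⟨x,u⟩ : x ∈ C}` of a set `C ⊆ ℝ³`. -/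
def suppFn (C : Set (EuclideanSpace ℝ (Fin 3))) (u : EuclideanSpace ℝ (Fin 3)) : ℝ :=
  sSup ((fun x => (inner ℝ x u : ℝ)) '' C)

/-- Mean width of `C`: `(1/(4π)) ∫_{S²} (h_C(u) + h_C(−u)) dσ(u)`, where `σ` is the
2-dimensional Hausdorff measure on the unit sphere. (For `C = ∅` this gives `0`.) -/
def meanWidth (C : Set (EuclideanSpace ℝ (Fin 3))) : ℝ :=
  (1 / (4 * π)) *
    ∫ u in Metric.sphere (0 : EuclideanSpace ℝ (Fin 3)) 1, (suppFn C u + suppFn C (-u)) ∂μH[2]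

/-- The rotation group `SO(3)` as 3×3 real orthogonal matrices of determinant 1. -/
abbrev SO3 := Matrix.specialOrthogonalGroup (Fin 3) ℝ

instance : MeasurableSpace SO3 := borel SO3

instance : BorelSpace SO3 := ⟨rfl⟩

/-- The action of a rotation `θ ∈ SO(3)` on a point of `ℝ³`. -/
def rotate (θ : SO3) (p : EuclideanSpace ℝ (Fin 3)) : EuclideanSpace ℝ (Fin 3) :=
  (EuclideanSpace.equiv (Fin 3) ℝ).symm (Matrix.mulVec θ.1 (EuclideanSpace.equiv (Fin 3) ℝ p))

/-- `θ·S + x`: the image of `S` under the rotation `θ` followed by translation by `x`. -/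
def moveSet (θ : SO3) (x : EuclideanSpace ℝ (Fin 3)) (S : Set (EuclideanSpace ℝ (Fin 3))) :
    Set (EuclideanSpace ℝ (Fin 3)) :=
  (fun p => rotate θ p + x) '' S

/-- The maximum of a linear form in two variables over the unit circle. -/
lemma isGreatest_linear_unitCircle (a b : ℝ) :
    IsGreatest {r : ℝ | ∃ p q : ℝ, p ^ 2 + q ^ 2 = 1 ∧ p * a + q * b = r}
      (Real.sqrt (a ^ 2 + b ^ 2)) := by
  constructor
  · by_cases hs : a ^ 2 + b ^ 2 = 0
    · have ha : a = 0 := by nlinarith [sq_nonneg a, sq_nonneg b]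
      have hb : b = 0 := by nlinarith [sq_nonneg a, sq_nonneg b]
      exact ⟨1, 0, by norm_num, by simp [ha, hb]⟩
    · have hpos : 0 < a ^ 2 + b ^ 2 := lt_of_le_of_ne (by positivity) (Ne.symm hs)
      have hr : Real.sqrt (a ^ 2 + b ^ 2) ≠ 0 := (Real.sqrt_pos.2 hpos).ne'
      have hsq := Real.sq_sqrt hpos.le
      refine ⟨a / Real.sqrt (a ^ 2 + b ^ 2), b / Real.sqrt (a ^ 2 + b ^ 2), ?_, ?_⟩
      · rw [div_pow, div_pow, hsq]
        field_simp
      · field_simp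
        exact hsq.symm
  · rintro r ⟨p, q, hpq, rfl⟩
    apply Real.le_sqrt_of_sq_le
    have lagrange : (p * a + q * b) ^ 2 + (p * b - q * a) ^ 2 =
        (p ^ 2 + q ^ 2) * (a ^ 2 + b ^ 2) := by ring
    rw [hpq, one_mul] at lagrange
    linarith [sq_nonneg (p * b - q * a)]

lemma inner_equiv_symm_vec (x : EuclideanSpace ℝ (Fin 3)) (a b c : ℝ) :
    inner ℝ x ((EuclideanSpace.equiv (Fin 3) ℝ).symm ![a, b, c]) =
      x 0 * a + x 1 * b + x 2 * c := by
  simp [PiLp.inner_apply, Fin.sum_univ_three, mul_comm]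

lemma mem_kA {p : EuclideanSpace ℝ (Fin 3)} :
    p ∈ kA ↔ p 0 ^ 2 + (p 1 + 1 / 2) ^ 2 = 1 ∧ p 2 = 0 := Iff.rfl

lemma mem_kB {p : EuclideanSpace ℝ (Fin 3)} :
    p ∈ kB ↔ (p 1 - 1 / 2) ^ 2 + p 2 ^ 2 = 1 ∧ p 0 = 0 := Iff.rfl

lemma isGreatest_inner_kA (a b c : ℝ) :
    IsGreatest ((fun x => inner ℝ x ((EuclideanSpace.equiv (Fin 3) ℝ).symm ![a, b, c])) '' kA)
      (Real.sqrt (a ^ 2 + b ^ 2) - b / 2) := by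
  obtain ⟨⟨p, q, hpq, hr⟩, hle⟩ := isGreatest_linear_unitCircle a b
  constructor
  · refine ⟨!₂[p, q - 1 / 2, 0], mem_kA.2 ?_, ?_⟩
    · simpa using hpq
    · simp only [inner_equiv_symm_vec]
      simp
      linarith
  · rintro _ ⟨x, hxk, rfl⟩
    obtain ⟨hx, hz⟩ := mem_kA.1 hxk
    have := hle ⟨x 0, x 1 + 1 / 2, hx, rfl⟩
    simp only [inner_equiv_symm_vec, hz]
    linarith

lemma isGreatest_inner_kB (a b c : ℝ) :
    IsGreatest ((fun x => inner ℝ x ((EuclideanSpace.equiv (Fin 3) ℝ).symm ![a, b, c])) '' kB)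
      (Real.sqrt (b ^ 2 + c ^ 2) + b / 2) := by
  obtain ⟨⟨p, q, hpq, hr⟩, hle⟩ := isGreatest_linear_unitCircle b c
  constructor
  · refine ⟨!₂[0, p + 1 / 2, q], mem_kB.2 ?_, ?_⟩
    · simpa using hpq
    · simp only [inner_equiv_symm_vec]
      simp
      linarith
  · rintro _ ⟨x, hxk, rfl⟩
    obtain ⟨hx, hz⟩ := mem_kB.1 hxk
    have := hle ⟨x 1 - 1 / 2, x 2, hx, rfl⟩
    simp only [inner_equiv_symm_vec, hz]
    linarith

/-- A linear functional has the same maximum over a set and over its convex hull. -/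
lemma isGreatest_inner_convexHull {E : Type*} [NormedAddCommGroup E] [InnerProductSpace ℝ E]
    {s : Set E} {u : E} {m : ℝ} (hm : IsGreatest ((fun x => inner ℝ x u) '' s) m) :
    IsGreatest ((fun x => inner ℝ x u) '' convexHull ℝ s) m := by
  refine ⟨Set.image_mono (subset_convexHull ℝ s) hm.1, ?_⟩
  have hconv : Convex ℝ {x : E | inner ℝ x u ≤ m} :=
    convex_halfSpace_le ⟨fun x y => inner_add_left x y u, fun r x => real_inner_smul_left x u r⟩ m
  rintro _ ⟨x, hx, rfl⟩
  exact convexHull_min (fun y hy => hm.2 ⟨y, hy, rfl⟩) hconv hx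

/-- For every unit vector `u = (a,b,c)`, the support function of the oloid `Ω₁` is
`max {√(a²+b²) − b/2, √(b²+c²) + b/2}`. -/
theorem suppFn_oloid (a b c : ℝ) (h : a ^ 2 + b ^ 2 + c ^ 2 = 1) :
    suppFn oloid ((EuclideanSpace.equiv (Fin 3) ℝ).symm ![a, b, c]) =
      max (Real.sqrt (a ^ 2 + b ^ 2) - b / 2) (Real.sqrt (b ^ 2 + c ^ 2) + b / 2) := by
  refine (isGreatest_inner_convexHull ?_).csSup_eq
  rw [Set.image_union]
  exact (isGreatest_inner_kA a b c).union (isGreatest_inner_kB a b c)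
end
end

section
/- The Lebesgue volume of the oloid Ω_r equals (2/3)·[ K(√3/2) + 2E(√3/2) ]·r³ for every r > 0; in particular the volume of Ω₁ is (2/3)·[K(√3/2) + 2E(√3/2)] ≈ 3.0524184684. -/
open MeasureTheory Real Pointwise

noncomputable section

/-- The Legendre radical `√(1 - k² sin² θ)` for the modulus `k = √3/2`. -/
def oloidDelta (θ : ℝ) : ℝ := √(1 - 3 / 4 * sin θ ^ 2)

/-- The reciprocal of the first coordinate of the endpoint on `k_A` of the ruling
with parameter `θ`. -/
def invCoordA (θ : ℝ) : ℝ := 2 * oloidDelta θ ^ 2 / (√3 * cos θ)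

/-- The reciprocal of the third coordinate of the endpoint on `k_B` of the ruling
with parameter `θ`. -/
def invCoordB (θ : ℝ) : ℝ := 1 / (√3 * (sin θ * oloidDelta θ))

/-- The ratio of the second to the first coordinate of the endpoint on `k_A` of the ruling
with parameter `θ`. -/
def slopeA (θ : ℝ) : ℝ := -(√3 / 4 * (sin θ ^ 2 / cos θ))

/-- The ratio of the second to the third coordinate of the endpoint on `k_B` of the ruling
with parameter `θ`. -/
def slopeB (θ : ℝ) : ℝ := √3 / 2 * (cos θ ^ 2 / (sin θ * oloidDelta θ))

/-- The negative of the derivative of `slopeA`. -/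
def slopeRateA (θ : ℝ) : ℝ := √3 / 4 * (sin θ * (1 + cos θ ^ 2) / cos θ ^ 2)

/-- The negative of the derivative of `slopeB`. -/
def slopeRateB (θ : ℝ) : ℝ :=
  √3 / 4 * (cos θ * (1 + cos θ ^ 2) / (sin θ ^ 2 * oloidDelta θ ^ 3))

lemma oloidDelta_arg_pos (θ : ℝ) : 0 < 1 - 3 / 4 * sin θ ^ 2 := by
  nlinarith [sin_sq_add_cos_sq θ, sq_nonneg (cos θ)]

lemma oloidDelta_pos (θ : ℝ) : 0 < oloidDelta θ := sqrt_pos.2 (oloidDelta_arg_pos θ)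

lemma oloidDelta_sq (θ : ℝ) : oloidDelta θ ^ 2 = 1 - 3 / 4 * sin θ ^ 2 :=
  sq_sqrt (oloidDelta_arg_pos θ).le

lemma continuous_oloidDelta : Continuous oloidDelta := by
  unfold oloidDelta
  fun_prop

lemma hasDerivAt_oloidDelta (θ : ℝ) :
    HasDerivAt oloidDelta (-(3 / 4 * (sin θ * cos θ) / oloidDelta θ)) θ := by
  have h := ((((hasDerivAt_sin θ).fun_pow 2).const_mul (3 / 4)).const_sub 1).sqrt
    (oloidDelta_arg_pos θ).ne'
  refine h.congr_deriv ?_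
  change _ / (2 * oloidDelta θ) = _
  have := oloidDelta_pos θ
  field_simp
  norm_num
  ring

lemma sin_pos_of_mem_quarter {θ : ℝ} (h : θ ∈ Set.Ioo 0 (π / 2)) : 0 < sin θ :=
  sin_pos_of_pos_of_lt_pi h.1 (by linarith [h.2, pi_pos])

lemma cos_pos_of_mem_quarter {θ : ℝ} (h : θ ∈ Set.Ioo 0 (π / 2)) : 0 < cos θ :=
  cos_pos_of_mem_Ioo ⟨by linarith [h.1, pi_pos], h.2⟩

lemma hasDerivAt_slopeA {θ : ℝ} (h : θ ∈ Set.Ioo 0 (π / 2)) :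
    HasDerivAt slopeA (-slopeRateA θ) θ := by
  have hc := cos_pos_of_mem_quarter h
  have h1 := ((((hasDerivAt_sin θ).fun_pow 2).div (hasDerivAt_cos θ) hc.ne').const_mul
    (√3 / 4)).neg
  refine h1.congr_deriv ?_
  unfold slopeRateA
  field_simp
  norm_num
  linear_combination (-sin θ) * sin_sq_add_cos_sq θ

lemma hasDerivAt_slopeB {θ : ℝ} (h : θ ∈ Set.Ioo 0 (π / 2)) :
    HasDerivAt slopeB (-slopeRateB θ) θ := by
  have hc := cos_pos_of_mem_quarter h
  have hs := sin_pos_of_mem_quarter h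
  have hD := oloidDelta_pos θ
  have h1 := (((hasDerivAt_cos θ).fun_pow 2).div ((hasDerivAt_sin θ).fun_mul
    (hasDerivAt_oloidDelta θ)) (mul_pos hs hD).ne').const_mul (√3 / 2)
  refine h1.congr_deriv ?_
  unfold slopeRateB
  have e1 := oloidDelta_sq θ
  have e2 : cos θ ^ 2 = 1 - sin θ ^ 2 := by linarith [sin_sq_add_cos_sq θ]
  field_simp
  norm_num
  simp only [e1]
  linear_combination ((-2 + 6 * sin θ ^ 2) * cos θ) * e2

lemma slopeRateA_pos {θ : ℝ} (h : θ ∈ Set.Ioo 0 (π / 2)) : 0 < slopeRateA θ := by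
  have hc := cos_pos_of_mem_quarter h
  have hs := sin_pos_of_mem_quarter h
  unfold slopeRateA
  positivity

lemma slopeRateB_pos {θ : ℝ} (h : θ ∈ Set.Ioo 0 (π / 2)) : 0 < slopeRateB θ := by
  have hc := cos_pos_of_mem_quarter h
  have hs := sin_pos_of_mem_quarter h
  have hD := oloidDelta_pos θ
  unfold slopeRateB
  positivity

lemma invCoordA_pos {θ : ℝ} (h : θ ∈ Set.Ioo 0 (π / 2)) : 0 < invCoordA θ := by
  have hc := cos_pos_of_mem_quarter h
  have hD := oloidDelta_pos θ
  unfold invCoordA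
  positivity

lemma invCoordB_pos {θ : ℝ} (h : θ ∈ Set.Ioo 0 (π / 2)) : 0 < invCoordB θ := by
  have hs := sin_pos_of_mem_quarter h
  have hD := oloidDelta_pos θ
  unfold invCoordB
  positivity

/-- The contribution of the ruling with parameter `θ` to the volume is a rational function of the
Legendre radical. -/
lemma triangle_integrand_eq {θ : ℝ} (h : θ ∈ Set.Ioo 0 (π / 2)) :
    4 * (slopeRateA θ / (6 * invCoordA θ ^ 2 * invCoordB θ) +
      slopeRateB θ / (6 * invCoordA θ * invCoordB θ ^ 2)) =
    1 / 3 * (2 * oloidDelta θ + 2 / oloidDelta θ + 1 / (2 * oloidDelta θ ^ 3)) := by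
  have hc := cos_pos_of_mem_quarter h
  have hs := sin_pos_of_mem_quarter h
  have hD := oloidDelta_pos θ
  have h3 : √3 ^ 2 = 3 := sq_sqrt (by norm_num)
  have e1 := oloidDelta_sq θ
  have e2 : cos θ ^ 2 = 4 / 3 * oloidDelta θ ^ 2 - 1 / 3 := by
    linarith [sin_sq_add_cos_sq θ]
  have e3 : sin θ ^ 2 = 4 / 3 - 4 / 3 * oloidDelta θ ^ 2 := by linarith
  have h34 : √3 ^ 4 = 9 := by
    rw [show (4 : ℕ) = 2 * 2 from rfl, pow_mul, h3]; norm_num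
  unfold slopeRateA slopeRateB invCoordA invCoordB
  field_simp
  simp only [h34, e2, e3]
  ring

lemma integral_inv_oloidDelta_cube :
    ∫ θ in (0 : ℝ)..(π / 2), 1 / oloidDelta θ ^ 3 =
      4 * ∫ θ in (0 : ℝ)..(π / 2), oloidDelta θ := by
  have hcont := continuous_oloidDelta
  have hne : ∀ θ, oloidDelta θ ^ 3 ≠ 0 := fun θ => (pow_pos (oloidDelta_pos θ) 3).ne'
  have hi : Continuous fun θ => 1 / oloidDelta θ ^ 3 := by fun_prop (disch := exact hne _)
  have key : ∫ θ in (0 : ℝ)..(π / 2), (oloidDelta θ - 1 / 4 * (1 / oloidDelta θ ^ 3)) = 0 := by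
    rw [intervalIntegral.integral_eq_sub_of_hasDerivAt
      (f := fun θ => 3 / 4 * (sin θ * cos θ / oloidDelta θ))]
    · simp
    · intro θ _
      have h1 := ((((hasDerivAt_sin θ).fun_mul (hasDerivAt_cos θ)).div
        (hasDerivAt_oloidDelta θ) (oloidDelta_pos θ).ne').const_mul (3 / 4))
      refine h1.congr_deriv ?_
      have hD := oloidDelta_pos θ
      have e2 : cos θ ^ 2 = 4 / 3 * oloidDelta θ ^ 2 - 1 / 3 := by
        linarith [sin_sq_add_cos_sq θ, oloidDelta_sq θ]
      have e3 : sin θ ^ 2 = 4 / 3 - 4 / 3 * oloidDelta θ ^ 2 := by linarith [oloidDelta_sq θ]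
      field_simp
      simp only [e2, e3]
      ring
    · exact (hcont.sub (hi.const_mul _)).intervalIntegrable _ _
  rw [intervalIntegral.integral_sub (hcont.intervalIntegrable _ _)
    ((hi.const_mul _).intervalIntegrable _ _), intervalIntegral.integral_const_mul] at key
  linarith

lemma integral_triangle_eq :
    ∫ θ in (0 : ℝ)..(π / 2),
      1 / 3 * (2 * oloidDelta θ + 2 / oloidDelta θ + 1 / (2 * oloidDelta θ ^ 3)) =
    2 / 3 * (ellipticK (√3 / 2) + 2 * ellipticE (√3 / 2)) := by
  have hcont := continuous_oloidDelta
  have hne : ∀ θ, oloidDelta θ ≠ 0 := fun θ => (oloidDelta_pos θ).ne'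
  have hi : Continuous fun θ => 1 / oloidDelta θ := by fun_prop (disch := exact hne _)
  have hi3 : Continuous fun θ => 1 / oloidDelta θ ^ 3 :=
    continuous_const.div₀ (hcont.pow 3) fun θ => pow_ne_zero 3 (hne θ)
  have hk : (√3 / 2) ^ 2 = 3 / 4 := by rw [div_pow, sq_sqrt (by norm_num)]; norm_num
  have hE : ellipticE (√3 / 2) = ∫ θ in (0 : ℝ)..(π / 2), oloidDelta θ := by
    unfold ellipticE oloidDelta
    rw [hk]
  have hK : ellipticK (√3 / 2) = ∫ θ in (0 : ℝ)..(π / 2), 1 / oloidDelta θ := by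
    unfold ellipticK oloidDelta
    rw [hk]
  have e : ∀ θ, 1 / 3 * (2 * oloidDelta θ + 2 / oloidDelta θ + 1 / (2 * oloidDelta θ ^ 3)) =
      2 / 3 * oloidDelta θ + 2 / 3 * (1 / oloidDelta θ) + 1 / 6 * (1 / oloidDelta θ ^ 3) := by
    intro θ
    have := hne θ
    field_simp
    ring
  simp only [e]
  rw [intervalIntegral.integral_add, intervalIntegral.integral_add,
    intervalIntegral.integral_const_mul, intervalIntegral.integral_const_mul,
    intervalIntegral.integral_const_mul, integral_inv_oloidDelta_cube, hE, hK]
  · ring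
  all_goals exact Continuous.intervalIntegrable (by fun_prop) _ _

lemma mul_add_mul_le_of_sq_add_sq {a b R x w : ℝ} (hR : 0 ≤ R) (hab : a ^ 2 + b ^ 2 = R ^ 2)
    (hxw : x ^ 2 + w ^ 2 = 1) : a * x + b * w ≤ R := by
  refine (abs_le_of_sq_le_sq' ?_ hR).2
  have : R ^ 2 = (a * x + b * w) ^ 2 + (a * w - b * x) ^ 2 := by
    rw [← hab]
    linear_combination (-(a ^ 2 + b ^ 2)) * hxw
  nlinarith [sq_nonneg (a * w - b * x)]

/-- The supporting half-space of the oloid with normal `(a, c, b)`, whose bounding plane touches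
both circles. -/
lemma oloid_support {a b c : ℝ} (hc : 0 ≤ 1 + c) (ha : a ^ 2 = 1 + 2 * c) (hb : b ^ 2 = 1 - c ^ 2)
    {p : EuclideanSpace ℝ (Fin 3)} (hp : p ∈ oloid) :
    a * p 0 + c * p 1 + b * p 2 ≤ 1 + c / 2 := by
  let L : EuclideanSpace ℝ (Fin 3) →ₗ[ℝ] ℝ :=
    { toFun := fun p => a * p 0 + c * p 1 + b * p 2
      map_add' := fun p q => by simp; ring
      map_smul' := fun t p => by simp; ring }
  have hconv : Convex ℝ {p : EuclideanSpace ℝ (Fin 3) | L p ≤ 1 + c / 2} :=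
    convex_halfSpace_le L.isLinear _
  have hsub : kA ∪ kB ⊆ {p : EuclideanSpace ℝ (Fin 3) | L p ≤ 1 + c / 2} := by
    rintro q (⟨h1, h2⟩ | ⟨h1, h2⟩)
    · change a * q 0 + c * q 1 + b * q 2 ≤ 1 + c / 2
      have := mul_add_mul_le_of_sq_add_sq (a := a) (b := c) hc (by rw [ha]; ring) h1
      rw [h2]
      linarith
    · change a * q 0 + c * q 1 + b * q 2 ≤ 1 + c / 2
      have := mul_add_mul_le_of_sq_add_sq (a := c) (b := b) zero_le_one (by rw [hb]; ring) h1
      rw [h2]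
      linarith
  exact convexHull_min hsub hconv hp

lemma zero_mem_oloid : (0 : EuclideanSpace ℝ (Fin 3)) ∈ oloid := by
  have h1 : !₂[0, 1 / 2, 0] ∈ oloid :=
    subset_convexHull ℝ _ (Or.inl ⟨by norm_num, rfl⟩)
  have h2 : !₂[0, -1 / 2, 0] ∈ oloid :=
    subset_convexHull ℝ _ (Or.inr ⟨by
      simp only [Matrix.cons_val_one, Matrix.cons_val]
      norm_num, rfl⟩)
  have h := (convex_convexHull ℝ (kA ∪ kB)) h1 h2 (a := 1 / 2) (b := 1 / 2)
    (by norm_num) (by norm_num) (by norm_num)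
  change _ ∈ oloid at h
  convert h using 1
  ext i
  fin_cases i <;> simp
  norm_num

/-- A point on the sector of the ruling with parameter `θ` lies in the oloid exactly if its
gauge is at most one. -/
lemma mem_oloid_iff_of_slope {θ : ℝ} (hθ : θ ∈ Set.Ioo 0 (π / 2))
    {p : EuclideanSpace ℝ (Fin 3)} (hx : p 0 ≠ 0) (hz : p 2 ≠ 0)
    (hy : p 1 = |p 0| * slopeA θ + |p 2| * slopeB θ) :
    p ∈ oloid ↔ |p 0| * invCoordA θ + |p 2| * invCoordB θ ≤ 1 := by
  have hC := cos_pos_of_mem_quarter hθ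
  have hs := sin_pos_of_mem_quarter hθ
  have hD := oloidDelta_pos θ
  have h3 : √3 ^ 2 = 3 := sq_sqrt (by norm_num)
  have h3p : 0 < √3 := by positivity
  have eD := oloidDelta_sq θ
  have eC : cos θ ^ 2 = 1 - sin θ ^ 2 := by linarith [sin_sq_add_cos_sq θ]
  have hu := invCoordA_pos hθ
  have hv := invCoordB_pos hθ
  obtain ⟨σ, hσ, hσx⟩ : ∃ σ : ℝ, σ ^ 2 = 1 ∧ p 0 = σ * |p 0| := by
    rcases abs_choice (p 0) with h | h
    · exact ⟨1, by norm_num, by rw [h, one_mul]⟩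
    · exact ⟨-1, by norm_num, by rw [h]; ring⟩
  obtain ⟨τ, hτ, hτz⟩ : ∃ τ : ℝ, τ ^ 2 = 1 ∧ p 2 = τ * |p 2| := by
    rcases abs_choice (p 2) with h | h
    · exact ⟨1, by norm_num, by rw [h, one_mul]⟩
    · exact ⟨-1, by norm_num, by rw [h]; ring⟩
  have hX := abs_pos.2 hx
  have hZ := abs_pos.2 hz
  generalize |p 0| = X at *
  generalize |p 2| = Z at *
  constructor
  · intro hp
    have hsup := oloid_support (a := σ * (√3 * cos θ)) (b := τ * (√3 * (sin θ * oloidDelta θ)))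
      (c := 1 - 3 / 2 * sin θ ^ 2) (by nlinarith [sq_nonneg (cos θ)])
      (by rw [mul_pow, mul_pow, hσ, h3, eC]; ring)
      (by rw [mul_pow, mul_pow, mul_pow, hτ, h3, eD]; ring) hp
    rw [hy, hσx, hτz] at hsup
    have e1 : √3 * cos θ + (1 - 3 / 2 * sin θ ^ 2) * slopeA θ =
        (3 / 2 - 3 / 4 * sin θ ^ 2) * invCoordA θ := by
      unfold slopeA invCoordA
      rw [eD]
      field_simp
      rw [h3, eC]
      ring
    have e2 : √3 * (sin θ * oloidDelta θ) + (1 - 3 / 2 * sin θ ^ 2) * slopeB θ =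
        (3 / 2 - 3 / 4 * sin θ ^ 2) * invCoordB θ := by
      unfold slopeB invCoordB
      field_simp
      rw [h3, eC, eD]
      ring
    have e3 : (3 / 2 - 3 / 4 * sin θ ^ 2) * (X * invCoordA θ + Z * invCoordB θ) ≤
        (3 / 2 - 3 / 4 * sin θ ^ 2) * 1 := by
      calc _ = X * ((3 / 2 - 3 / 4 * sin θ ^ 2) * invCoordA θ) +
            Z * ((3 / 2 - 3 / 4 * sin θ ^ 2) * invCoordB θ) := by ring
        _ ≤ _ := by
          rw [← e1, ← e2]
          linear_combination hsup - X * √3 * cos θ * hσ -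
            Z * √3 * sin θ * oloidDelta θ * hτ
    exact le_of_mul_le_mul_left e3 (by nlinarith [sq_nonneg (cos θ)])
  · intro hle
    have hA : !₂[σ / invCoordA θ, slopeA θ / invCoordA θ, 0] ∈ oloid := by
      refine subset_convexHull ℝ _ (Or.inl ⟨?_, by simp⟩)
      simp only [Matrix.cons_val_zero, Matrix.cons_val_one]
      rw [div_pow, hσ]
      unfold slopeA invCoordA
      rw [eD]
      have : 4 - 3 * sin θ ^ 2 ≠ 0 := by nlinarith [sq_nonneg (cos θ)]
      field_simp
      simp only [h3, eC]
      ring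
    have hB : !₂[0, slopeB θ / invCoordB θ, τ / invCoordB θ] ∈ oloid := by
      refine subset_convexHull ℝ _ (Or.inr ⟨?_, by simp⟩)
      simp only [Matrix.cons_val_one, Matrix.cons_val]
      rw [div_pow τ, hτ]
      unfold slopeB invCoordB
      field_simp
      simp only [h3, eC, eD]
      ring
    have hw : 0 < X * invCoordA θ + Z * invCoordB θ := by positivity
    have hAB := (convex_convexHull ℝ (kA ∪ kB)) hA hB
      (a := X * invCoordA θ / (X * invCoordA θ + Z * invCoordB θ))
      (b := Z * invCoordB θ / (X * invCoordA θ + Z * invCoordB θ))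
      (by positivity) (by positivity) (by field_simp)
    have h := (convex_convexHull ℝ (kA ∪ kB)) hAB zero_mem_oloid hw.le (sub_nonneg.2 hle)
      (add_sub_cancel _ _)
    change _ ∈ oloid at h
    convert h using 1
    ext i
    fin_cases i
    · simp [hσx]
      field_simp
    · simp [hy]
      field_simp
    · simp [hτz]
      field_simp

lemma continuousOn_slopeA : ContinuousOn slopeA (Set.Ioo 0 (π / 2)) :=
  fun _ h => (hasDerivAt_slopeA h).continuousAt.continuousWithinAt

lemma continuousOn_slopeB : ContinuousOn slopeB (Set.Ioo 0 (π / 2)) :=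
  fun _ h => (hasDerivAt_slopeB h).continuousAt.continuousWithinAt

open Filter Topology in
/-- Over a point of the horizontal quadrant, every height is attained by some ruling sector. -/
lemma exists_slope_eq {X Z : ℝ} (hX : 0 < X) (hZ : 0 < Z) (y : ℝ) :
    ∃ θ ∈ Set.Ioo 0 (π / 2), X * slopeA θ + Z * slopeB θ = y := by
  have hpi : (0 : ℝ) < π / 2 := by positivity
  have h3 : 0 < √3 := by positivity
  have hD0 : oloidDelta 0 = 1 := by simp [oloidDelta]
  have hDc := continuous_oloidDelta
  have : (𝓝[Set.Ioo 0 (π / 2)] (0 : ℝ)).NeBot := left_nhdsWithin_Ioo_neBot hpi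
  have : (𝓝[Set.Ioo 0 (π / 2)] (π / 2)).NeBot := right_nhdsWithin_Ioo_neBot hpi
  have key := isPreconnected_Ioo.intermediate_value_Iii (s := Set.Ioo 0 (π / 2))
    (l₁ := 𝓝[Set.Ioo 0 (π / 2)] (π / 2)) (l₂ := 𝓝[Set.Ioo 0 (π / 2)] 0)
    (f := fun θ => X * slopeA θ + Z * slopeB θ) inf_le_right inf_le_right
    ((continuousOn_const.mul continuousOn_slopeA).add
      (continuousOn_const.mul continuousOn_slopeB)) ?_ ?_
  · obtain ⟨θ, h, e⟩ := key (Set.mem_univ y)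
    exact ⟨θ, h, e⟩
  · refine Tendsto.atBot_add (C := Z * slopeB (π / 2)) ?_ ?_
    · have hcos : Tendsto cos (𝓝[Set.Ioo 0 (π / 2)] (π / 2)) (𝓝[>] 0) := by
        refine tendsto_nhdsWithin_iff.2 ⟨?_, ?_⟩
        · have := continuous_cos.tendsto (π / 2)
          rw [cos_pi_div_two] at this
          exact this.mono_left inf_le_left
        · filter_upwards [self_mem_nhdsWithin] with θ hθ using cos_pos_of_mem_quarter hθ
      have hsin : Tendsto (fun θ => sin θ ^ 2) (𝓝[Set.Ioo 0 (π / 2)] (π / 2)) (𝓝 1) := by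
        have := (continuous_sin.pow 2).tendsto (π / 2)
        simp only [Pi.pow_apply, sin_pi_div_two, one_pow] at this
        exact this.mono_left inf_le_left
      have h := ((hsin.pos_mul_atTop one_pos hcos.inv_tendsto_nhdsGT_zero).const_mul_atTop
        (mul_pos hX (by positivity : 0 < √3 / 4)))
      refine (tendsto_neg_atTop_atBot.comp h).congr fun θ => ?_
      simp [slopeA, div_eq_mul_inv]
      ring
    · have : ContinuousAt slopeB (π / 2) := by
        unfold slopeB
        have := (oloidDelta_pos (π / 2)).ne'
        fun_prop (disch := simp [this])
      exact (this.tendsto.const_mul Z).mono_left inf_le_left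
  · refine Tendsto.add_atTop (C := X * slopeA 0) ?_ ?_
    · have : ContinuousAt slopeA 0 := by
        unfold slopeA
        fun_prop (disch := simp)
      exact (this.tendsto.const_mul X).mono_left inf_le_left
    · have hden : Tendsto (fun θ => sin θ * oloidDelta θ) (𝓝[Set.Ioo 0 (π / 2)] 0) (𝓝[>] 0) := by
        refine tendsto_nhdsWithin_iff.2 ⟨?_, ?_⟩
        · have hcts : Continuous fun θ => sin θ * oloidDelta θ := continuous_sin.mul hDc
          have := hcts.tendsto 0
          rw [sin_zero, zero_mul] at this
          exact this.mono_left inf_le_left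
        · filter_upwards [self_mem_nhdsWithin] with θ hθ
          exact mul_pos (sin_pos_of_mem_quarter hθ) (oloidDelta_pos θ)
      have hnum : Tendsto (fun θ => cos θ ^ 2) (𝓝[Set.Ioo 0 (π / 2)] 0) (𝓝 1) := by
        have := (continuous_cos.pow 2).tendsto 0
        simp only [Pi.pow_apply, cos_zero, one_pow] at this
        exact this.mono_left inf_le_left
      have h := ((hnum.pos_mul_atTop one_pos hden.inv_tendsto_nhdsGT_zero).const_mul_atTop
        (mul_pos hZ (by positivity : 0 < √3 / 2)))
      refine h.congr fun θ => ?_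
      simp [slopeB, div_eq_mul_inv]
      ring

lemma lintegral_comp_abs_eq {f : ℝ → ENNReal} (hf : Measurable f) :
    ∫⁻ x, f |x| = 2 * ∫⁻ x in Set.Ioi 0, f x := by
  have hpos : ∫⁻ x in Set.Ioi (0 : ℝ), f |x| = ∫⁻ x in Set.Ioi 0, f x :=
    setLIntegral_congr_fun measurableSet_Ioi fun x hx => by
      simp only [abs_of_pos (Set.mem_Ioi.1 hx)]
  have hneg : ∫⁻ x in Set.Iic (0 : ℝ), f |x| = ∫⁻ x in Set.Ioi 0, f x := by
    rw [← restrict_Iio_eq_restrict_Iic,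
      ← (Measure.measurePreserving_neg volume).setLIntegral_comp_preimage measurableSet_Ioi hf]
    have : (Neg.neg : ℝ → ℝ) ⁻¹' Set.Ioi 0 = Set.Iio 0 := by
      ext x
      simp
    rw [this]
    exact setLIntegral_congr_fun measurableSet_Iio fun x hx => by
      simp only [abs_of_neg (Set.mem_Iio.1 hx)]
  rw [← lintegral_add_compl _ (measurableSet_Ioi (a := (0 : ℝ))), Set.compl_Ioi, hpos, hneg,
    two_mul]

lemma setLIntegral_Ioc_ofReal {f : ℝ → ℝ} {a b : ℝ} (hab : a ≤ b) (hf : Continuous f)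
    (h0 : ∀ x ∈ Set.Ioc a b, 0 ≤ f x) :
    ∫⁻ x in Set.Ioc a b, ENNReal.ofReal (f x) = ENNReal.ofReal (∫ x in a..b, f x) := by
  rw [intervalIntegral.integral_of_le hab, ofReal_integral_eq_lintegral_ofReal]
  · exact (hf.intervalIntegrable a b).1
  · exact (ae_restrict_iff' measurableSet_Ioc).2 (Filter.Eventually.of_forall h0)

/-- The linear density `X M + Z N` restricted to the triangle `X u + Z v ≤ 1`. -/
def triangleDensity (u v M N X Z : ℝ) : ENNReal :=
  if X * u + Z * v ≤ 1 then ENNReal.ofReal (X * M + Z * N) else 0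

lemma setLIntegral_triangleDensity_right {u v M N X : ℝ} (hv : 0 < v) (hM : 0 ≤ M)
    (hN : 0 ≤ N) (hX : 0 < X) (hXu : X * u ≤ 1) :
    ∫⁻ Z in Set.Ioi 0, triangleDensity u v M N X Z =
      ENNReal.ofReal (X * M * ((1 - X * u) / v) + N * ((1 - X * u) / v) ^ 2 / 2) := by
  have hw : 0 ≤ (1 - X * u) / v := div_nonneg (by linarith) hv.le
  have hfun : (fun Z => triangleDensity u v M N X Z) =
      (Set.Iic ((1 - X * u) / v)).indicator fun Z => ENNReal.ofReal (X * M + Z * N) := by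
    ext Z
    have : X * u + Z * v ≤ 1 ↔ Z ≤ (1 - X * u) / v := by
      rw [le_div_iff₀ hv]
      constructor <;> intro h <;> linarith
    simp [triangleDensity, Set.indicator_apply, this]
  rw [hfun, setLIntegral_indicator measurableSet_Iic, Set.inter_comm, Set.Ioi_inter_Iic,
    setLIntegral_Ioc_ofReal hw (by fun_prop)]
  · rw [intervalIntegral.integral_add (by simp)
      (Continuous.intervalIntegrable (by fun_prop) _ _), intervalIntegral.integral_const,
      intervalIntegral.integral_mul_const, integral_id, smul_eq_mul]
    congr 1
    ring
  · intro Z hZ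
    have := hZ.1
    positivity

lemma setLIntegral_triangleDensity {u v M N : ℝ} (hu : 0 < u) (hv : 0 < v) (hM : 0 ≤ M)
    (hN : 0 ≤ N) :
    ∫⁻ X in Set.Ioi 0, ∫⁻ Z in Set.Ioi 0, triangleDensity u v M N X Z =
      ENNReal.ofReal (M / (6 * u ^ 2 * v) + N / (6 * u * v ^ 2)) := by
  have hinner : Set.EqOn (fun X => ∫⁻ Z in Set.Ioi 0, triangleDensity u v M N X Z)
      ((Set.Iic (1 / u)).indicator fun X =>
        ENNReal.ofReal (X * M * ((1 - X * u) / v) + N * ((1 - X * u) / v) ^ 2 / 2))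
      (Set.Ioi 0) := by
    intro X hX
    by_cases h : X ≤ 1 / u
    · rw [Set.indicator_of_mem (Set.mem_Iic.2 h)]
      exact setLIntegral_triangleDensity_right hv hM hN hX ((le_div_iff₀ hu).1 h)
    · rw [Set.indicator_of_notMem (by simpa using h)]
      have h1 : 1 < X * u := (div_lt_iff₀ hu).1 (not_le.1 h)
      refine (setLIntegral_congr_fun measurableSet_Ioi (g := fun _ => 0) fun Z hZ => ?_).trans
        (by simp)
      have := mul_pos (Set.mem_Ioi.1 hZ) hv
      exact if_neg (by linarith)
  rw [setLIntegral_congr_fun measurableSet_Ioi hinner, setLIntegral_indicator measurableSet_Iic,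
    Set.inter_comm, Set.Ioi_inter_Iic, setLIntegral_Ioc_ofReal (by positivity) (by fun_prop)]
  · congr 1
    have hd : ∀ X ∈ Set.uIcc 0 (1 / u), HasDerivAt
        (fun X => M / v * (X ^ 2 / 2 - u * X ^ 3 / 3) - N / (6 * u * v ^ 2) * (1 - X * u) ^ 3)
        (X * M * ((1 - X * u) / v) + N * ((1 - X * u) / v) ^ 2 / 2) X := by
      intro X _
      have h1 : HasDerivAt (fun X : ℝ => X) 1 X := hasDerivAt_id' X
      have h2 := ((((h1.fun_pow 2).div_const 2).sub
        (((h1.fun_pow 3).const_mul u).div_const 3)).const_mul (M / v)).sub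
        ((((h1.mul_const u).const_sub 1).fun_pow 3).const_mul (N / (6 * u * v ^ 2)))
      refine h2.congr_deriv ?_
      norm_num
      field_simp
      ring
    rw [intervalIntegral.integral_eq_sub_of_hasDerivAt hd
      (Continuous.intervalIntegrable (by fun_prop) _ _)]
    field_simp
    ring
  · intro X hX
    have h1 := hX.1
    have h2 : 0 ≤ 1 - X * u := by linarith [(le_div_iff₀ hu).1 hX.2]
    positivity

lemma measurable_oloidDelta : Measurable oloidDelta := continuous_oloidDelta.measurable

lemma measurable_invCoordA : Measurable invCoordA := by
  have := measurable_oloidDelta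
  unfold invCoordA
  fun_prop

lemma measurable_invCoordB : Measurable invCoordB := by
  have := measurable_oloidDelta
  unfold invCoordB
  fun_prop

lemma measurable_slopeRateA : Measurable slopeRateA := by
  unfold slopeRateA
  fun_prop

lemma measurable_slopeRateB : Measurable slopeRateB := by
  have := measurable_oloidDelta
  unfold slopeRateB
  fun_prop

/-- The density of the oloid with respect to the ruling parameter `θ` over a point whose
horizontal coordinates have absolute values `X` and `Z`. -/
def rulingDensity (X Z θ : ℝ) : ENNReal :=
  triangleDensity (invCoordA θ) (invCoordB θ) (slopeRateA θ) (slopeRateB θ) X Z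

lemma measurable_rulingDensity :
    Measurable fun q : (ℝ × ℝ) × ℝ => rulingDensity q.1.1 q.1.2 q.2 := by
  have h1 := measurable_invCoordA
  have h2 := measurable_invCoordB
  have h3 := measurable_slopeRateA
  have h4 := measurable_slopeRateB
  exact Measurable.ite (measurableSet_le (by fun_prop) measurable_const) (by fun_prop)
    measurable_const

/-- The length of a vertical slice of the oloid. -/
lemma lintegral_indicator_slice {x z : ℝ} (hx : x ≠ 0) (hz : z ≠ 0) :
    ∫⁻ y, ((fun y : ℝ => !₂[x, y, z]) ⁻¹' oloid).indicator 1 y =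
      ∫⁻ θ in Set.Ioo 0 (π / 2), rulingDensity |x| |z| θ := by
  have hX := abs_pos.2 hx
  have hZ := abs_pos.2 hz
  set f : ℝ → ℝ := fun θ => |x| * slopeA θ + |z| * slopeB θ with hf
  set s : Set ℝ := {θ | |x| * invCoordA θ + |z| * invCoordB θ ≤ 1} with hs
  have hsm : MeasurableSet s := by
    have h1 := measurable_invCoordA
    have h2 := measurable_invCoordB
    exact measurableSet_le (by fun_prop) measurable_const
  have hdom : MeasurableSet (s ∩ Set.Ioo 0 (π / 2)) := hsm.inter measurableSet_Ioo
  have hder : ∀ θ ∈ Set.Ioo 0 (π / 2),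
      HasDerivAt f (-(|x| * slopeRateA θ + |z| * slopeRateB θ)) θ := fun θ hθ =>
    (((hasDerivAt_slopeA hθ).const_mul |x|).add
      ((hasDerivAt_slopeB hθ).const_mul |z|)).congr_deriv (by ring)
  have hrate : ∀ θ ∈ Set.Ioo 0 (π / 2), 0 < |x| * slopeRateA θ + |z| * slopeRateB θ :=
    fun θ hθ => add_pos (mul_pos hX (slopeRateA_pos hθ)) (mul_pos hZ (slopeRateB_pos hθ))
  have hcont : ContinuousOn f (Set.Ioo 0 (π / 2)) :=
    fun θ hθ => (hder θ hθ).continuousAt.continuousWithinAt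
  have hinj : Set.InjOn f (Set.Ioo 0 (π / 2)) := by
    refine (strictAntiOn_of_deriv_neg (convex_Ioo _ _) hcont fun θ hθ => ?_).injOn
    rw [interior_Ioo] at hθ
    rw [(hder θ hθ).deriv]
    linarith [hrate θ hθ]
  have hset : (fun y : ℝ => !₂[x, y, z]) ⁻¹' oloid = f '' (s ∩ Set.Ioo 0 (π / 2)) := by
    ext y
    constructor
    · intro hy
      obtain ⟨θ, hθ, e⟩ := exists_slope_eq hX hZ y
      exact ⟨θ, ⟨(mem_oloid_iff_of_slope (p := !₂[x, y, z]) hθ hx hz e.symm).1 hy, hθ⟩, e⟩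
    · rintro ⟨θ, ⟨hθs, hθ⟩, e⟩
      exact (mem_oloid_iff_of_slope (p := !₂[x, y, z]) hθ hx hz e.symm).2 hθs
  rw [hset, lintegral_indicator (hdom.image_of_continuousOn_injOn
    (hcont.mono Set.inter_subset_right) (hinj.mono Set.inter_subset_right)),
    lintegral_image_eq_lintegral_abs_deriv_mul hdom
      (fun θ hθ => (hder θ hθ.2).hasDerivWithinAt) (hinj.mono Set.inter_subset_right),
    ← setLIntegral_indicator hsm]
  refine setLIntegral_congr_fun measurableSet_Ioo fun θ hθ => ?_
  simp only [Set.indicator_apply, rulingDensity, triangleDensity, hs, Set.mem_ofPred_eq,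
    Pi.one_apply, mul_one, abs_neg, abs_of_pos (hrate θ hθ)]

lemma measurePreserving_coords :
    MeasurePreserving fun q : ℝ × ℝ × ℝ => (!₂[q.2.1, q.1, q.2.2] : EuclideanSpace ℝ (Fin 3)) := by
  have h := (PiLp.volume_preserving_toLp (Fin 3)).comp
    ((volume_preserving_piFinSuccAbove (fun _ : Fin 3 => ℝ) 1).symm.comp
      ((MeasurePreserving.id (volume : Measure ℝ)).prod (volume_preserving_finTwoArrow ℝ).symm))
  refine (congrArg (fun f => MeasurePreserving f volume volume) ?_).mp h
  ext q i
  fin_cases i <;> rfl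

/-- The total mass of the density of the oloid at a fixed ruling parameter. -/
lemma lintegral_rulingDensity_abs {θ : ℝ} (hθ : θ ∈ Set.Ioo 0 (π / 2)) :
    ∫⁻ w : ℝ × ℝ, rulingDensity |w.1| |w.2| θ = ENNReal.ofReal
      (1 / 3 * (2 * oloidDelta θ + 2 / oloidDelta θ + 1 / (2 * oloidDelta θ ^ 3))) := by
  have hsection : Measurable fun w : ℝ × ℝ => rulingDensity w.1 w.2 θ :=
    measurable_rulingDensity.comp (g := fun q : (ℝ × ℝ) × ℝ => rulingDensity q.1.1 q.1.2 q.2)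
      (f := fun w : ℝ × ℝ => (w, θ)) (by fun_prop)
  have hsec_abs : Measurable fun w : ℝ × ℝ => rulingDensity |w.1| |w.2| θ :=
    hsection.comp (g := fun w : ℝ × ℝ => rulingDensity w.1 w.2 θ)
      (f := fun w : ℝ × ℝ => (|w.1|, |w.2|)) (by fun_prop)
  have hinner (X : ℝ) : ∫⁻ z, rulingDensity X |z| θ =
      2 * ∫⁻ Z in Set.Ioi 0, rulingDensity X Z θ := by
    have hX : Measurable fun Z => rulingDensity X Z θ :=
      hsection.comp (g := fun w : ℝ × ℝ => rulingDensity w.1 w.2 θ)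
        (f := fun Z : ℝ => (X, Z)) (by fun_prop)
    exact lintegral_comp_abs_eq hX
  have hint : Measurable fun X => ∫⁻ Z in Set.Ioi 0, rulingDensity X Z θ :=
    hsection.lintegral_prod_right'
  rw [Measure.volume_eq_prod, lintegral_prod _ hsec_abs.aemeasurable]
  simp only [hinner]
  rw [lintegral_comp_abs_eq (f := fun X => 2 * ∫⁻ Z in Set.Ioi 0, rulingDensity X Z θ)
    (hint.const_mul 2), lintegral_const_mul _ hint]
  simp only [rulingDensity]
  rw [setLIntegral_triangleDensity (invCoordA_pos hθ) (invCoordB_pos hθ)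
    (slopeRateA_pos hθ).le (slopeRateB_pos hθ).le, ← triangle_integrand_eq hθ,
    ENNReal.ofReal_mul (by norm_num), ← mul_assoc]
  norm_num

lemma volume_oloid :
    volume oloid =
      ENNReal.ofReal (2 / 3 * (ellipticK (√3 / 2) + 2 * ellipticE (√3 / 2))) := by
  have hmp := measurePreserving_coords
  have hnull : NullMeasurableSet oloid := (convex_convexHull ℝ (kA ∪ kB)).nullMeasurableSet _
  have hnull' := hnull.preimage hmp.quasiMeasurePreserving
  have hne : ∀ᵐ x : ℝ, x ≠ 0 := by simp [ae_iff]
  have hmeas := measurable_rulingDensity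
  have habs : Measurable fun q : (ℝ × ℝ) × ℝ => rulingDensity |q.1.1| |q.1.2| q.2 :=
    hmeas.comp (by fun_prop : Measurable fun q : (ℝ × ℝ) × ℝ => ((|q.1.1|, |q.1.2|), q.2))
  have hae : ∀ᵐ w : ℝ × ℝ, ∫⁻ y, ((fun q : ℝ × ℝ × ℝ => (!₂[q.2.1, q.1, q.2.2] :
      EuclideanSpace ℝ (Fin 3))) ⁻¹' oloid).indicator 1 (y, w) =
      ∫⁻ θ in Set.Ioo 0 (π / 2), rulingDensity |w.1| |w.2| θ := by
    filter_upwards [Measure.quasiMeasurePreserving_fst.ae hne,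
      Measure.quasiMeasurePreserving_snd.ae hne] with w h1 h2
    exact lintegral_indicator_slice h1 h2
  calc volume oloid = ∫⁻ w : ℝ × ℝ, ∫⁻ y, ((fun q : ℝ × ℝ × ℝ => (!₂[q.2.1, q.1, q.2.2] :
        EuclideanSpace ℝ (Fin 3))) ⁻¹' oloid).indicator 1 (y, w) := by
        rw [← hmp.measure_preimage hnull, ← lintegral_indicator_one₀ hnull']
        exact lintegral_prod_symm _ (aemeasurable_one.indicator₀ hnull')
    _ = ∫⁻ w : ℝ × ℝ, ∫⁻ θ in Set.Ioo 0 (π / 2), rulingDensity |w.1| |w.2| θ :=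
        lintegral_congr_ae hae
    _ = ∫⁻ θ in Set.Ioo 0 (π / 2), ∫⁻ w : ℝ × ℝ, rulingDensity |w.1| |w.2| θ :=
        lintegral_lintegral_swap habs.aemeasurable
    _ = ∫⁻ θ in Set.Ioc 0 (π / 2), ENNReal.ofReal
          (1 / 3 * (2 * oloidDelta θ + 2 / oloidDelta θ + 1 / (2 * oloidDelta θ ^ 3))) := by
        rw [setLIntegral_congr_fun measurableSet_Ioo
          fun θ hθ => lintegral_rulingDensity_abs hθ, restrict_Ioo_eq_restrict_Ioc]
    _ = _ := by
        have hD := oloidDelta_pos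
        have hDc := continuous_oloidDelta
        rw [setLIntegral_Ioc_ofReal (by positivity), integral_triangle_eq]
        · exact continuous_const.mul (((continuous_const.mul hDc).add
            (continuous_const.div₀ hDc fun θ => (hD θ).ne')).add
            (continuous_const.div₀ (continuous_const.mul (hDc.pow 3)) fun θ =>
              (mul_pos two_pos (pow_pos (hD θ) 3)).ne'))
        · intro θ _
          have := hD θ
          positivity

/-- The Lebesgue volume of the oloid `Ω_r` equals `(2/3)·[K(√3/2) + 2E(√3/2)]·r³`
for every `r > 0`. -/
theorem volume_oloidR (r : ℝ) (hr : 0 < r) :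
    volume (oloidR r) =
      ENNReal.ofReal ((2 / 3) * (ellipticK (Real.sqrt 3 / 2) + 2 * ellipticE (Real.sqrt 3 / 2))
        * r ^ 3) := by
  unfold oloidR
  rw [Measure.addHaar_smul, volume_oloid, finrank_euclideanSpace_fin,
    abs_of_pos (pow_pos hr 3), ← ENNReal.ofReal_mul (pow_pos hr 3).le, mul_comm]
end
end
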